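/- Let l be a positive integer and let E, F be sets of nonnegative integers with E ∪ F = [0, 3·2^(2l+1) − 4], 0 ∈ E, and E ∩ F = {2^(2l+1) − 2, 2^(2l+1) − 1}. If R_E(n) = R_F(n) for every integer n ∈ [0, 3·2^(2l+1) − 4], then E = A_{2l+1} ∪ (2^(2l+1) − 2 + B_{2l+1}) ∪ (2^(2l+2) − 2 + (B_{2l+1} ∩ [0, 2^(2l+1) − 3])) ∪ {3·2^(2l+1) − 4} and F = B_{2l+1} ∪ (2^(2l+1) − 2 + A_{2l+1}) ∪ (2^(2l+2) − 2 + (A_{2l+1} ∩ [0, 2^(2l+1) − 3])). -/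

import Mathlib

/-- `R S n` is the number of pairs `(s, s')` with `s, s' ∈ S`, `s < s'` and `s + s' = n`. -/
noncomputable def R (S : Set ℕ) (n : ℕ) : ℕ :=
  Set.ncard {p : ℕ × ℕ | p.1 ∈ S ∧ p.2 ∈ S ∧ p.1 < p.2 ∧ p.1 + p.2 = n}

/-- `AP r m` is the arithmetic progression `r + mℕ = {r + m*k : k ∈ ℕ}`. -/
def AP (r m : ℕ) : Set ℕ := {n | ∃ k : ℕ, n = r + m * k}

/-- The Thue–Morse set: nonnegative integers with an even number of binary digits 1. -/
def TMA : Set ℕ := {n | Even ((Nat.digits 2 n).sum)}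

/-- Complement of the Thue–Morse set. -/
def TMB : Set ℕ := {n | ¬ Even ((Nat.digits 2 n).sum)}

/-- `TMAl l = A ∩ [0, 2^l - 1]`. -/
def TMAl (l : ℕ) : Set ℕ := TMA ∩ Set.Icc 0 (2 ^ l - 1)

/-- `TMBl l = B ∩ [0, 2^l - 1]`. -/
def TMBl (l : ℕ) : Set ℕ := TMB ∩ Set.Icc 0 (2 ^ l - 1)

/-- The set `E` of Claim 3. -/
def Eset (l : ℕ) : Set ℕ :=
  TMAl (2 * l + 1) ∪ ((fun x => 2 ^ (2 * l + 1) - 2 + x) '' TMBl (2 * l + 1)) ∪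
    ((fun x => 2 ^ (2 * l + 2) - 2 + x) ''
      (TMBl (2 * l + 1) ∩ Set.Icc 0 (2 ^ (2 * l + 1) - 3))) ∪
    {3 * 2 ^ (2 * l + 1) - 4}

/-- The set `F` of Claim 3. -/
def Fset (l : ℕ) : Set ℕ :=
  TMBl (2 * l + 1) ∪ ((fun x => 2 ^ (2 * l + 1) - 2 + x) '' TMAl (2 * l + 1)) ∪
    ((fun x => 2 ^ (2 * l + 2) - 2 + x) ''
      (TMAl (2 * l + 1) ∩ Set.Icc 0 (2 ^ (2 * l + 1) - 3)))

open Finset in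
open scoped Classical in
/-- Ordered pairs with sum `n` are counted by twice `R S n` plus the diagonal term. -/
lemma sum_antidiagonal_indicator (S : Set ℕ) (n : ℕ) :
    ∑ x ∈ antidiagonal n, S.indicator (1 : ℕ → ℤ) x.1 * S.indicator (1 : ℕ → ℤ) x.2 =
      2 * R S n + if Even n then S.indicator (1 : ℕ → ℤ) (n / 2) else 0 := by
  have hRcard : R S n = #{x ∈ antidiagonal n | x.1 < x.2 ∧ x.1 ∈ S ∧ x.2 ∈ S} := by
    rw [R, ← Set.ncard_coe_finset]
    congr 1
    ext ⟨a, b⟩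
    simp only [Set.mem_ofPred_eq, coe_filter, HasAntidiagonal.mem_antidiagonal]
    tauto
  have hlt : ∑ x ∈ antidiagonal n with x.1 < x.2,
      S.indicator (1 : ℕ → ℤ) x.1 * S.indicator (1 : ℕ → ℤ) x.2 = R S n := by
    rw [hRcard, ← filter_filter, card_filter]
    push_cast
    refine sum_congr rfl fun x _ => ?_
    by_cases h1 : x.1 ∈ S <;> by_cases h2 : x.2 ∈ S <;> simp [h1, h2]
  have hgt : ∑ x ∈ antidiagonal n with x.2 < x.1,
      S.indicator (1 : ℕ → ℤ) x.1 * S.indicator (1 : ℕ → ℤ) x.2 = R S n := by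
    rw [← hlt]
    refine sum_bij' (fun x _ => x.swap) (fun x _ => x.swap) ?_ ?_ ?_ ?_ ?_ <;>
      simp +contextual [add_comm, mul_comm]
  have heq : ∑ x ∈ antidiagonal n with x.1 = x.2,
      S.indicator (1 : ℕ → ℤ) x.1 * S.indicator (1 : ℕ → ℤ) x.2 =
        if Even n then S.indicator (1 : ℕ → ℤ) (n / 2) else 0 := by
    split_ifs with hn
    · obtain ⟨k, rfl⟩ := hn
      have : {x ∈ antidiagonal (k + k) | x.1 = x.2} = {(k, k)} := by
        ext ⟨a, b⟩
        simp only [mem_filter, HasAntidiagonal.mem_antidiagonal, mem_singleton, Prod.mk.injEq]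
        omega
      have hk : (k + k) / 2 = k := by omega
      rw [this, sum_singleton, hk]
      by_cases h : k ∈ S <;> simp [h]
    · refine sum_eq_zero fun x hx => ?_
      simp only [mem_filter, HasAntidiagonal.mem_antidiagonal] at hx
      exact absurd ⟨x.1, by omega⟩ hn
  rw [← sum_filter_add_sum_filter_not _ (fun x : ℕ × ℕ => x.1 = x.2), heq,
    ← sum_filter_add_sum_filter_not (filter _ _) (fun x : ℕ × ℕ => x.1 < x.2),
    filter_filter, filter_filter]
  have h1 : {x ∈ antidiagonal n | ¬x.1 = x.2 ∧ x.1 < x.2} =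
      {x ∈ antidiagonal n | x.1 < x.2} := filter_congr fun x _ => by omega
  have h2 : {x ∈ antidiagonal n | ¬x.1 = x.2 ∧ ¬x.1 < x.2} =
      {x ∈ antidiagonal n | x.2 < x.1} := filter_congr fun x _ => by omega
  rw [h1, h2, hlt, hgt]
  ring

/-- The `{1, 0, -1}`-valued difference of the indicators of two sets. -/
noncomputable def indicatorDiff (E F : Set ℕ) (n : ℕ) : ℤ :=
  E.indicator 1 n - F.indicator 1 n

open Finset in
lemma sum_indicatorDiff_mul (E F : Set ℕ) (n : ℕ) (h : R E n = R F n) :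
    ∑ x ∈ antidiagonal n, indicatorDiff E F x.1 *
        (E.indicator (1 : ℕ → ℤ) x.2 + F.indicator (1 : ℕ → ℤ) x.2) =
      if Even n then indicatorDiff E F (n / 2) else 0 := by
  have hE := sum_antidiagonal_indicator E n
  have hF := sum_antidiagonal_indicator F n
  have hswap : ∑ x ∈ antidiagonal n, E.indicator (1 : ℕ → ℤ) x.1 * F.indicator (1 : ℕ → ℤ) x.2 =
      ∑ x ∈ antidiagonal n, F.indicator (1 : ℕ → ℤ) x.1 * E.indicator (1 : ℕ → ℤ) x.2 := by
    rw [← Nat.sum_antidiagonal_swap]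
    simp [mul_comm]
  simp only [indicatorDiff, sub_mul, mul_add, sum_sub_distrib, sum_add_distrib]
  rw [hE, hF, hswap, h]
  split_ifs <;> ring

open Finset in
/-- If `E ∪ F = [0, N]` and `E ∩ F = {M, M + 1}`, equality of the representation functions at `n`
expresses a partial sum of the indicator difference. -/
lemma sum_range_indicatorDiff (E F : Set ℕ) (M N n : ℕ) (hn : n ≤ N)
    (hU : E ∪ F = Set.Icc 0 N) (hI : E ∩ F = {M, M + 1}) (h : R E n = R F n) :
    ∑ i ∈ range (n + 1), indicatorDiff E F i +
        (if M ≤ n then indicatorDiff E F (n - M) else 0) +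
        (if M + 1 ≤ n then indicatorDiff E F (n - (M + 1)) else 0) =
      if Even n then indicatorDiff E F (n / 2) else 0 := by
  rw [← sum_indicatorDiff_mul E F n h]
  have key : ∀ x ∈ antidiagonal n, indicatorDiff E F x.1 *
      (E.indicator (1 : ℕ → ℤ) x.2 + F.indicator (1 : ℕ → ℤ) x.2) =
      indicatorDiff E F x.1 + (if x.2 = M then indicatorDiff E F x.1 else 0) +
        (if x.2 = M + 1 then indicatorDiff E F x.1 else 0) := by
    intro x hx
    rw [HasAntidiagonal.mem_antidiagonal] at hx
    have h1 : x.2 ∈ E ∨ x.2 ∈ F := by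
      have : x.2 ∈ E ∪ F := by rw [hU, Set.mem_Icc]; omega
      exact this
    have h2 : x.2 ∈ E ∧ x.2 ∈ F ↔ x.2 = M ∨ x.2 = M + 1 := by
      rw [← Set.mem_inter_iff, hI]; simp
    have h3 : E.indicator (1 : ℕ → ℤ) x.2 + F.indicator (1 : ℕ → ℤ) x.2 =
        1 + (if x.2 = M then 1 else 0) + (if x.2 = M + 1 then 1 else 0) := by
      by_cases hE : x.2 ∈ E <;> by_cases hF : x.2 ∈ F <;>
        simp only [hE, hF, and_self, and_true, and_false, true_iff, false_iff, not_or,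
          or_self] at h1 h2 <;>
        simp only [hE, hF, Set.indicator_of_mem, Set.indicator_of_notMem, not_false_eq_true,
          Pi.one_apply] <;>
        split_ifs <;> omega
    rw [h3, mul_add, mul_add, mul_one, mul_ite, mul_ite, mul_one, mul_zero]
  rw [sum_congr rfl key, sum_add_distrib, sum_add_distrib,
    Nat.sum_antidiagonal_eq_sum_range_succ_mk]
  have pick : ∀ m, ∑ x ∈ antidiagonal n, (if x.2 = m then indicatorDiff E F x.1 else 0) =
      if m ≤ n then indicatorDiff E F (n - m) else 0 := by
    intro m
    split_ifs with hm
    · rw [sum_eq_single_of_mem (n - m, m) (by simp [hm])]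
      · simp
      · rintro ⟨a, b⟩ hx hne
        rw [HasAntidiagonal.mem_antidiagonal] at hx
        refine if_neg fun hb => hne ?_
        simp only [Prod.mk.injEq] at hx hb ⊢
        omega
    · refine sum_eq_zero fun x hx => if_neg fun hb => ?_
      rw [HasAntidiagonal.mem_antidiagonal] at hx
      omega
  rw [pick, pick]

/-- The recursion for the indicator difference. -/
lemma indicatorDiff_rec (E F : Set ℕ) (M N : ℕ)
    (hU : E ∪ F = Set.Icc 0 N) (hI : E ∩ F = {M, M + 1})
    (hR : ∀ n ≤ N, R E n = R F n) (n : ℕ) (hn0 : 0 < n) (hn : n ≤ N) :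
    indicatorDiff E F n =
      (if Even n then indicatorDiff E F (n / 2) else -indicatorDiff E F (n / 2)) -
        (if M ≤ n then indicatorDiff E F (n - M) else 0) +
        (if M + 2 ≤ n then indicatorDiff E F (n - (M + 2)) else 0) := by
  obtain ⟨k, rfl⟩ := Nat.exists_eq_succ_of_ne_zero hn0.ne'
  simp only [Nat.succ_eq_add_one] at *
  have h1 := sum_range_indicatorDiff E F M N (k + 1) hn hU hI (hR _ hn)
  have h2 := sum_range_indicatorDiff E F M N k (by omega) hU hI (hR _ (by omega))
  rw [Finset.sum_range_succ] at h1
  simp only [Nat.add_le_add_iff_right, Nat.add_sub_add_right,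
    show M + 2 ≤ k + 1 ↔ M + 1 ≤ k by omega, show k + 1 - (M + 2) = k - (M + 1) by omega] at h1 ⊢
  have hdiv : ¬ Even (k + 1) → (k + 1) / 2 = k / 2 := by
    rw [Nat.even_iff]; omega
  rcases Nat.even_or_odd k with he | ho
  · have hne : ¬ Even (k + 1) := by simpa [Nat.even_add_one] using he
    simp only [he, hne, if_true, if_false, hdiv hne] at h1 h2 ⊢
    linarith
  · have hne : ¬ Even k := by simpa using ho
    have he : Even (k + 1) := by simpa [Nat.even_add_one] using hne
    simp only [he, hne, if_true, if_false] at h1 h2 ⊢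
    linarith

/-- The sign sequence of Thue and Morse. -/
def thueMorse (n : ℕ) : ℤ := (-1) ^ (Nat.digits 2 n).sum

@[simp] lemma thueMorse_zero : thueMorse 0 = 1 := by simp [thueMorse]

lemma thueMorse_two_mul (n : ℕ) : thueMorse (2 * n) = thueMorse n := by
  rcases Nat.eq_zero_or_pos n with rfl | hn
  · rfl
  · simp [thueMorse, Nat.digits_base_mul one_lt_two hn]

lemma thueMorse_two_mul_add_one (n : ℕ) : thueMorse (2 * n + 1) = -thueMorse n := by
  rw [thueMorse, Nat.digits_add_two_add_one 0 (2 * n)]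
  have h1 : (2 * n + 1) % 2 = 1 := by omega
  have h2 : (2 * n + 1) / 2 = n := by omega
  simp [thueMorse, h1, h2, pow_add]

lemma thueMorse_eq_ite (n : ℕ) :
    thueMorse n = if Even n then thueMorse (n / 2) else -thueMorse (n / 2) := by
  split_ifs with h
  · conv_lhs => rw [← Nat.two_mul_div_two_of_even h]
    exact thueMorse_two_mul _
  · conv_lhs => rw [← Nat.two_mul_div_two_add_one_of_odd (Nat.not_even_iff_odd.1 h)]
    exact thueMorse_two_mul_add_one _

lemma thueMorse_two_pow_add (k j : ℕ) (h : j < 2 ^ k) :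
    thueMorse (2 ^ k + j) = -thueMorse j := by
  induction k generalizing j with
  | zero =>
    obtain rfl : j = 0 := by simpa using h
    simpa using thueMorse_two_mul_add_one 0
  | succ k ih =>
    rw [pow_succ] at h ⊢
    have := ih (j / 2) (by omega)
    rcases Nat.even_or_odd' j with ⟨i, rfl | rfl⟩
    · rw [show 2 ^ k * 2 + 2 * i = 2 * (2 ^ k + i) by ring, thueMorse_two_mul,
        thueMorse_two_mul, ih i (by omega)]
    · rw [show 2 ^ k * 2 + (2 * i + 1) = 2 * (2 ^ k + i) + 1 by ring, thueMorse_two_mul_add_one,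
        thueMorse_two_mul_add_one, ih i (by omega)]

lemma thueMorse_two_pow_sub_one (k : ℕ) : thueMorse (2 ^ k - 1) = (-1) ^ k := by
  induction k with
  | zero => simp
  | succ k ih =>
    have := Nat.two_pow_pos k
    rw [show 2 ^ (k + 1) - 1 = 2 * (2 ^ k - 1) + 1 by rw [pow_succ]; omega,
      thueMorse_two_mul_add_one, ih, pow_succ]
    ring

lemma mem_TMA_iff (n : ℕ) : n ∈ TMA ↔ thueMorse n = 1 := by
  simp only [TMA, Set.mem_ofPred_eq, thueMorse]
  rw [neg_one_pow_eq_one_iff_even (by norm_num)]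

lemma mem_TMB_iff (n : ℕ) : n ∈ TMB ↔ thueMorse n = -1 := by
  simp only [TMB, Set.mem_ofPred_eq, thueMorse]
  rw [neg_one_pow_eq_neg_one_iff_odd (by norm_num), Nat.not_even_iff_odd]

lemma thueMorse_eq_or (n : ℕ) : thueMorse n = 1 ∨ thueMorse n = -1 :=
  neg_one_pow_eq_or ℤ _

/-- The solution of the recursion of `indicatorDiff_rec`, as a signed concatenation of Thue–Morse
words. -/
def signedBlocks (M n : ℕ) : ℤ :=
  if n < M then thueMorse n
  else if n < M + 2 then 0
  else if n < 2 * M + 2 then -thueMorse (n - M)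
  else if n < 3 * M + 2 then -thueMorse (n - (2 * M + 2))
  else 1

lemma eq_signedBlocks (M : ℕ) (hM : 6 ≤ M) (hE : Even M) (p : ℕ → ℤ) (h0 : p 0 = 1)
    (hadd : ∀ j < M + 2, thueMorse (M + 2 + j) = -thueMorse j)
    (hMt : thueMorse M = 1) (hMt2 : thueMorse (M - 2) = -1)
    (hp : ∀ n, 0 < n → n ≤ 3 * M + 2 → p n =
      (if Even n then p (n / 2) else -p (n / 2)) -
        (if M ≤ n then p (n - M) else 0) + (if M + 2 ≤ n then p (n - (M + 2)) else 0))
    (n : ℕ) (hn : n ≤ 3 * M + 2) : p n = signedBlocks M n := by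
  obtain ⟨m, rfl⟩ := hE
  have t1 : thueMorse 1 = -1 := by simpa using thueMorse_two_mul_add_one 0
  have t2 : thueMorse 2 = -1 := by simpa [t1] using thueMorse_two_mul 1
  have t3 : thueMorse 3 = 1 := by simpa [t1] using thueMorse_two_mul_add_one 1
  have hm : thueMorse m = 1 := by rw [← thueMorse_two_mul, two_mul, hMt]
  have hm2 : thueMorse (m - 1) = -1 := by
    rw [← thueMorse_two_mul, ← hMt2]; congr 1; omega
  have hMt1 : thueMorse (m + m + 1) = -1 := by
    rw [← two_mul, thueMorse_two_mul_add_one, hm]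
  have hMt3 : thueMorse (m + m - 1) = 1 := by
    rw [show m + m - 1 = 2 * (m - 1) + 1 by omega, thueMorse_two_mul_add_one, hm2]; rfl
  have hm3 : thueMorse (m + 1) = -1 := by
    have := hadd 0 (by omega)
    rw [← thueMorse_two_mul, show 2 * (m + 1) = m + m + 2 + 0 by ring, this, thueMorse_zero]
  induction n using Nat.strong_induction_on with
  | _ n ih =>
  rcases Nat.eq_zero_or_pos n with rfl | hpos
  · rw [h0, signedBlocks, if_pos (by omega), thueMorse_zero]
  have e1 := hp n hpos hn
  have ih1 := ih (n / 2) (by omega) (by omega)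
  have ht := thueMorse_eq_ite n
  by_cases hA : n < m + m
  · rw [e1, ih1, if_neg (by omega : ¬ m + m ≤ n), if_neg (by omega : ¬ m + m + 2 ≤ n),
      signedBlocks, signedBlocks, if_pos hA, if_pos (by omega : n / 2 < m + m), ht]
    ring
  have ih2 := ih (n - (m + m)) (by omega) (by omega)
  rw [if_pos (by omega : m + m ≤ n), ih1, ih2] at e1
  by_cases hB : n < m + m + 2
  · rw [if_neg (by omega : ¬ m + m + 2 ≤ n)] at e1
    simp only [signedBlocks, if_pos (by omega : n / 2 < m + m),
      if_pos (by omega : n - (m + m) < m + m), ← ht] at e1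
    simp only [signedBlocks, if_neg hA, if_pos hB]
    obtain rfl | rfl : n = m + m ∨ n = m + m + 1 := by omega
    · simpa [hMt] using e1
    · simpa [hMt1, t1] using e1
  have ih3 := ih (n - (m + m + 2)) (by omega) (by omega)
  rw [if_pos (by omega : m + m + 2 ≤ n), ih3] at e1
  by_cases hC : n < 2 * (m + m)
  · simp only [signedBlocks, if_pos (by omega : n / 2 < m + m),
      if_pos (by omega : n - (m + m) < m + m),
      if_pos (by omega : n - (m + m + 2) < m + m), ← ht] at e1
    have := hadd (n - (m + m + 2)) (by omega)
    rw [show m + m + 2 + (n - (m + m + 2)) = n by omega] at this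
    simp only [signedBlocks, if_neg hA, if_neg hB, if_pos (by omega : n < 2 * (m + m) + 2)]
    linarith
  by_cases hD : n < 2 * (m + m) + 2
  · have hd : n / 2 = m + m := by omega
    simp only [signedBlocks, hd, lt_irrefl, if_false, if_pos (by omega : m + m < m + m + 2),
      if_neg (by omega : ¬ n - (m + m) < m + m), if_pos (by omega : n - (m + m) < m + m + 2),
      if_pos (by omega : n - (m + m + 2) < m + m)] at e1
    simp only [signedBlocks, if_neg hA, if_neg hB, if_pos hD]
    obtain h | h : n = 2 * (m + m) ∨ n = 2 * (m + m) + 1 := by omega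
    · rw [show n - (m + m) = m + m by omega, hMt]
      rw [show n - (m + m + 2) = m + m - 2 by omega, hMt2] at e1
      simpa using e1
    · rw [show n - (m + m) = m + m + 1 by omega, hMt1]
      rw [show n - (m + m + 2) = m + m - 1 by omega, hMt3] at e1
      simpa using e1
  by_cases hF : n < 2 * (m + m) + 4
  · have hd : n / 2 = m + m + 1 := by omega
    simp only [signedBlocks, hd, if_neg (by omega : ¬ m + m + 1 < m + m),
      if_pos (by omega : m + m + 1 < m + m + 2),
      if_neg (by omega : ¬ n - (m + m) < m + m), if_neg (by omega : ¬ n - (m + m) < m + m + 2),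
      if_pos (by omega : n - (m + m) < 2 * (m + m) + 2),
      if_neg (by omega : ¬ n - (m + m + 2) < m + m),
      if_pos (by omega : n - (m + m + 2) < m + m + 2)] at e1
    simp only [signedBlocks, if_neg hA, if_neg hB, if_neg hD,
      if_pos (by omega : n < 3 * (m + m) + 2)]
    obtain h | h : n = 2 * (m + m) + 2 ∨ n = 2 * (m + m) + 3 := by omega
    · rw [show n - (2 * (m + m) + 2) = 0 by omega, thueMorse_zero]
      rw [show n - (m + m) - (m + m) = 2 by omega, t2] at e1
      simpa using e1
    · rw [show n - (2 * (m + m) + 2) = 1 by omega, t1]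
      rw [show n - (m + m) - (m + m) = 3 by omega, t3] at e1
      simpa using e1
  by_cases hG : n < 3 * (m + m) + 2
  · have ht' := thueMorse_eq_ite (n - 2 * (m + m))
    rw [show (n - 2 * (m + m)) / 2 = n / 2 - (m + m) by omega] at ht'
    have hpar : Even (n - 2 * (m + m)) ↔ Even n := by
      rw [Nat.even_iff, Nat.even_iff]; omega
    simp only [hpar] at ht'
    simp only [signedBlocks, if_neg (by omega : ¬ n / 2 < m + m),
      if_neg (by omega : ¬ n / 2 < m + m + 2), if_pos (by omega : n / 2 < 2 * (m + m) + 2),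
      if_neg (by omega : ¬ n - (m + m) < m + m), if_neg (by omega : ¬ n - (m + m) < m + m + 2),
      if_pos (by omega : n - (m + m) < 2 * (m + m) + 2),
      if_neg (by omega : ¬ n - (m + m + 2) < m + m),
      if_neg (by omega : ¬ n - (m + m + 2) < m + m + 2),
      if_pos (by omega : n - (m + m + 2) < 2 * (m + m) + 2)] at e1
    simp only [signedBlocks, if_neg hA, if_neg hB, if_neg hD, if_pos hG]
    rw [show n - (m + m) - (m + m) = n - 2 * (m + m) by omega, ht',
      show n - (m + m + 2) - (m + m) = n - (2 * (m + m) + 2) by omega] at e1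
    rw [e1]
    split_ifs <;> ring
  · obtain rfl : n = 3 * (m + m) + 2 := by omega
    have hev : Even (3 * (m + m) + 2) := by rw [Nat.even_iff]; omega
    simp only [signedBlocks, if_pos hev, if_neg (by omega : ¬ (3 * (m + m) + 2) / 2 < m + m),
      if_neg (by omega : ¬ (3 * (m + m) + 2) / 2 < m + m + 2),
      if_pos (by omega : (3 * (m + m) + 2) / 2 < 2 * (m + m) + 2),
      if_neg (by omega : ¬ 3 * (m + m) + 2 - (m + m) < m + m),
      if_neg (by omega : ¬ 3 * (m + m) + 2 - (m + m) < m + m + 2),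
      if_neg (by omega : ¬ 3 * (m + m) + 2 - (m + m) < 2 * (m + m) + 2),
      if_pos (by omega : 3 * (m + m) + 2 - (m + m) < 3 * (m + m) + 2),
      if_neg (by omega : ¬ 3 * (m + m) + 2 - (m + m + 2) < m + m),
      if_neg (by omega : ¬ 3 * (m + m) + 2 - (m + m + 2) < m + m + 2),
      if_pos (by omega : 3 * (m + m) + 2 - (m + m + 2) < 2 * (m + m) + 2)] at e1
    simp only [signedBlocks, if_neg hA, if_neg hB, if_neg hD, if_neg hG]
    rw [show (3 * (m + m) + 2) / 2 - (m + m) = m + 1 by omega, hm3,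
      show 3 * (m + m) + 2 - (m + m) - (2 * (m + m) + 2) = 0 by omega, thueMorse_zero,
      show 3 * (m + m) + 2 - (m + m + 2) - (m + m) = m + m by omega, hMt] at e1
    simpa using e1

lemma exists_and_add_eq_iff (P : ℕ → Prop) (c n : ℕ) :
    (∃ x, P x ∧ c + x = n) ↔ c ≤ n ∧ P (n - c) :=
  ⟨by rintro ⟨x, hx, rfl⟩; simpa using hx, fun ⟨h, hP⟩ => ⟨n - c, hP, by omega⟩⟩

lemma mem_Eset_iff (l M n : ℕ) (hM : 2 ^ (2 * l + 1) = M + 2) (hM6 : 6 ≤ M)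
    (hMt : thueMorse M = 1) :
    n ∈ Eset l ↔ n ≤ 3 * M + 2 ∧ (signedBlocks M n = 1 ∨ n = M ∨ n = M + 1) := by
  have hM' : 2 ^ (2 * l + 2) = 2 * M + 4 := by rw [pow_succ, hM]; ring
  have t1 : thueMorse 1 = -1 := by simpa using thueMorse_two_mul_add_one 0
  simp only [Eset, TMAl, TMBl, hM, hM', Set.mem_union, Set.mem_inter_iff, Set.mem_image,
    Set.mem_Icc, Set.mem_singleton_iff, mem_TMA_iff, mem_TMB_iff]
  rw [exists_and_add_eq_iff, exists_and_add_eq_iff, show M + 2 - 2 = M by omega,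
    show 2 * M + 4 - 2 = 2 * M + 2 by omega]
  have hn := thueMorse_eq_or n
  unfold signedBlocks
  have t0 := thueMorse_zero
  clear hM hM'
  split_ifs <;> grind

lemma mem_Fset_iff (l M n : ℕ) (hM : 2 ^ (2 * l + 1) = M + 2) (hM6 : 6 ≤ M)
    (hMt : thueMorse (M + 1) = -1) :
    n ∈ Fset l ↔ n ≤ 3 * M + 2 ∧ (signedBlocks M n = -1 ∨ n = M ∨ n = M + 1) := by
  have hM' : 2 ^ (2 * l + 2) = 2 * M + 4 := by rw [pow_succ, hM]; ring
  have t1 : thueMorse 1 = -1 := by simpa using thueMorse_two_mul_add_one 0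
  simp only [Fset, TMAl, TMBl, hM, hM', Set.mem_union, Set.mem_inter_iff, Set.mem_image,
    Set.mem_Icc, mem_TMA_iff, mem_TMB_iff]
  rw [exists_and_add_eq_iff, exists_and_add_eq_iff, show M + 2 - 2 = M by omega,
    show 2 * M + 4 - 2 = 2 * M + 2 by omega]
  have hn := thueMorse_eq_or n
  unfold signedBlocks
  have t0 := thueMorse_zero
  clear hM hM'
  split_ifs <;> grind

theorem stmt_8 (l : ℕ) (hl : 0 < l) (E F : Set ℕ)
    (hU : E ∪ F = Set.Icc 0 (3 * 2 ^ (2 * l + 1) - 4)) (h0 : 0 ∈ E)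
    (hI : E ∩ F = {2 ^ (2 * l + 1) - 2, 2 ^ (2 * l + 1) - 1})
    (hR : ∀ n ≤ 3 * 2 ^ (2 * l + 1) - 4, R E n = R F n) :
    E = Eset l ∧ F = Fset l := by
  obtain ⟨M, hM, hM6⟩ : ∃ M, 2 ^ (2 * l + 1) = M + 2 ∧ 6 ≤ M := by
    have : 2 ^ 3 ≤ 2 ^ (2 * l + 1) := Nat.pow_le_pow_right (by norm_num) (by omega)
    exact ⟨2 ^ (2 * l + 1) - 2, by omega, by omega⟩
  rw [hM, show 3 * (M + 2) - 4 = 3 * M + 2 by omega] at hU hR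
  rw [hM, show M + 2 - 2 = M by omega, show M + 2 - 1 = M + 1 by omega] at hI
  have hev : Even M := by
    have : Even (M + 2) := hM ▸ (by simp [Nat.even_pow])
    rw [Nat.even_iff] at this ⊢
    omega
  have t1 : thueMorse (M + 1) = -1 := by
    have := thueMorse_two_pow_sub_one (2 * l + 1)
    rw [hM, show M + 2 - 1 = M + 1 by omega] at this
    rw [this]
    exact Odd.neg_one_pow ⟨l, rfl⟩
  have t0 : thueMorse M = 1 := by
    have := thueMorse_eq_ite (M + 1)
    rw [t1, if_neg (by rw [Nat.even_add_one]; simpa using hev)] at this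
    rw [thueMorse_eq_ite, if_pos hev]
    rw [Nat.even_iff] at hev
    rw [show (M + 1) / 2 = M / 2 by omega] at this
    linarith
  have t2 : thueMorse (M - 2) = -1 := by
    have h4 : M - 2 = 2 * (2 * (2 ^ (2 * l - 1) - 1)) := by
      have : 2 ^ (2 * l + 1) = 4 * 2 ^ (2 * l - 1) := by
        rw [show 2 * l + 1 = 2 * l - 1 + 2 by omega, pow_add]; ring
      omega
    rw [h4, thueMorse_two_mul, thueMorse_two_mul, thueMorse_two_pow_sub_one]
    exact Odd.neg_one_pow ⟨l - 1, by omega⟩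
  have hinter : ∀ n, n ∈ E ∧ n ∈ F ↔ n = M ∨ n = M + 1 := fun n => by
    rw [← Set.mem_inter_iff, hI]; simp
  have hunion : ∀ n, n ∈ E ∨ n ∈ F ↔ n ≤ 3 * M + 2 := fun n => by
    rw [← Set.mem_union, hU]; simp
  have h0F : 0 ∉ F := fun h => by
    have := (hinter 0).1 ⟨h0, h⟩
    omega
  have hsol := eq_signedBlocks M hM6 hev (indicatorDiff E F) (by simp [indicatorDiff, h0, h0F])
    (fun j hj => by rw [← hM] at hj ⊢; exact thueMorse_two_pow_add _ _ hj) t0 t2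
    (fun n hn hn' => indicatorDiff_rec E F M _ hU hI hR n hn hn')
  constructor <;> ext n
  · rw [mem_Eset_iff l M n hM hM6 t0, ← hinter, ← hunion]
    by_cases hn : n ≤ 3 * M + 2
    · rw [← hsol n hn]
      have := (hunion n).2 hn
      by_cases h1 : n ∈ E <;> by_cases h2 : n ∈ F <;> simp_all [indicatorDiff]
    · have := mt (hunion n).1 hn
      tauto
  · rw [mem_Fset_iff l M n hM hM6 t1, ← hinter, ← hunion]
    by_cases hn : n ≤ 3 * M + 2
    · rw [← hsol n hn]
      have := (hunion n).2 hn
      by_cases h1 : n ∈ E <;> by_cases h2 : n ∈ F <;> simp_all [indicatorDiff]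
    · have := mt (hunion n).1 hn
      tauto
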